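/- For density matrices ρ, σ and any γ ≥ 1, the Hockey-stick divergence satisfies E_γ(ρ‖σ) ≥ 1 - γ^{1-s}·Q̄_s(ρ‖σ) for s ∈ (0,1), where Q̄_s(ρ‖σ) = Tr[ρ^s σ^{1-s}]. -/

import Mathlib

open Matrix BigOperators
open scoped ComplexOrder

open scoped Classical in
/-- `Tr[X₊]`: sum of the nonnegative eigenvalues of a Hermitian matrix (0 otherwise). -/
noncomputable def trPos {n : Type*} [Fintype n] [DecidableEq n] (X : Matrix n n ℂ) : ℝ :=
  if h : X.IsHermitian then ∑ i, max (h.eigenvalues i) 0 else 0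

/-- Hockey-stick divergence `E_γ(ρ‖σ) = Tr(ρ - γσ)₊`. -/
noncomputable def Egamma {n : Type*} [Fintype n] [DecidableEq n]
    (γ : ℝ) (ρ σ : Matrix n n ℂ) : ℝ :=
  trPos (ρ - (γ : ℂ) • σ)

/-- Trace norm `‖A‖₁ = Tr√(AᴴA)`: sum of singular values. -/
noncomputable def traceNorm {n : Type*} [Fintype n] [DecidableEq n] (A : Matrix n n ℂ) : ℝ :=
  ∑ i, Real.sqrt (((Matrix.posSemidef_conjTranspose_mul_self A).1).eigenvalues i)

/-- Real power `ρ^α` of a Hermitian matrix via its spectral decomposition. -/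
noncomputable def mpow {n : Type*} [Fintype n] [DecidableEq n]
    {ρ : Matrix n n ℂ} (hρ : ρ.IsHermitian) (α : ℝ) : Matrix n n ℂ :=
  (hρ.eigenvectorUnitary : Matrix n n ℂ) *
    Matrix.diagonal (fun i => ((hρ.eigenvalues i ^ α : ℝ) : ℂ)) *
    (star hρ.eigenvectorUnitary : Matrix n n ℂ)

/-- Fidelity `F(ρ,σ) = ‖√ρ√σ‖₁`. -/
noncomputable def fid {n : Type*} [Fintype n] [DecidableEq n]
    {ρ σ : Matrix n n ℂ} (hρ : ρ.IsHermitian) (hσ : σ.IsHermitian) : ℝ :=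
  traceNorm (mpow hρ (1/2) * mpow hσ (1/2))

/-- A density matrix: positive semidefinite with unit trace. -/
def IsDensity {n : Type*} [Fintype n] [DecidableEq n] (ρ : Matrix n n ℂ) : Prop :=
  ρ.PosSemidef ∧ ρ.trace = 1

open scoped MatrixOrder Matrix.Norms.L2Operator

section TraceInequality

variable {n : Type*} [Fintype n] [DecidableEq n]

lemma cfc_eq_eigenvectorUnitary_mul_diagonal {A : Matrix n n ℂ} (hA : A.IsHermitian) (f : ℝ → ℝ) :
    cfc f A = (hA.eigenvectorUnitary : Matrix n n ℂ) *
      Matrix.diagonal (fun i => ((f (hA.eigenvalues i) : ℝ) : ℂ)) *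
      (star hA.eigenvectorUnitary : Matrix n n ℂ) := by
  rw [hA.cfc_eq, Matrix.IsHermitian.cfc, Unitary.conjStarAlgAut_apply]
  rfl

lemma trace_cfc {A : Matrix n n ℂ} (hA : A.IsHermitian) (f : ℝ → ℝ) :
    (cfc f A).trace = ∑ i, ((f (hA.eigenvalues i) : ℝ) : ℂ) := by
  rw [cfc_eq_eigenvectorUnitary_mul_diagonal hA, Matrix.trace_mul_cycle, Unitary.coe_star_mul_self,
    one_mul, Matrix.trace_diagonal]

lemma mpow_eq_rpow {A : Matrix n n ℂ} (hA : A.PosSemidef) (α : ℝ) : mpow hA.1 α = A ^ α := by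
  rw [CFC.rpow_eq_cfc_real hA.nonneg, cfc_eq_eigenvectorUnitary_mul_diagonal hA.1]
  rfl

lemma trPos_eq_trace_cfc {A : Matrix n n ℂ} (hA : A.IsHermitian) :
    trPos A = (cfc (fun x : ℝ => max x 0) A).trace.re := by
  rw [trPos, dif_pos hA, trace_cfc hA]
  simp

lemma rpow_mul_rpow_one_sub {A : Matrix n n ℂ} (hA : 0 ≤ A) {s : ℝ} :
    A ^ s * A ^ (1 - s) = A := by
  have hsa : IsSelfAdjoint A := .of_nonneg hA
  rw [CFC.rpow_eq_cfc_real hA, CFC.rpow_eq_cfc_real hA,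
    ← cfc_mul _ _ A (A.finite_real_spectrum.continuousOn _) (A.finite_real_spectrum.continuousOn _)]
  conv_rhs => rw [← cfc_id ℝ A]
  refine cfc_congr fun x hx => ?_
  have hx0 : 0 ≤ x := spectrum_nonneg_of_nonneg hA hx
  rw [← Real.rpow_add' hx0 (by simp)]
  simp

lemma smul_rpow_of_nonneg {A : Matrix n n ℂ} (hA : 0 ≤ A) {c : ℝ} (hc : 0 ≤ c) (p : ℝ) :
    (c • A) ^ p = c ^ p • A ^ p := by
  have hsa : IsSelfAdjoint A := .of_nonneg hA
  rw [CFC.rpow_eq_cfc_real hA, CFC.rpow_eq_cfc_real (smul_nonneg hc hA),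
    ← cfc_comp_const_mul c _ A ((A.finite_real_spectrum.image _).continuousOn _),
    ← cfc_smul _ _ A (A.finite_real_spectrum.continuousOn _)]
  exact cfc_congr fun x hx => Real.mul_rpow hc (spectrum_nonneg_of_nonneg hA hx)

lemma re_trace_mul_nonneg {A B : Matrix n n ℂ} (hA : 0 ≤ A) (hB : 0 ≤ B) :
    0 ≤ (A * B).trace.re := by
  obtain ⟨C, rfl⟩ := CStarAlgebra.nonneg_iff_eq_star_mul_self.mp hB
  rw [← mul_assoc, Matrix.trace_mul_cycle]
  exact (Complex.nonneg_iff.mp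
    ((Matrix.nonneg_iff_posSemidef.mp hA).mul_mul_conjTranspose_same C).trace_nonneg).1

lemma re_trace_mul_le_mul_left {A B C : Matrix n n ℂ} (hA : 0 ≤ A) (hBC : B ≤ C) :
    (A * B).trace.re ≤ (A * C).trace.re := by
  simpa [mul_sub] using re_trace_mul_nonneg hA (sub_nonneg.mpr hBC)

/-- The trace inequality behind the quantum Chernoff bound, due to Audenaert et al. -/
lemma re_trace_sub_trPos_le {A B : Matrix n n ℂ} (hA : 0 ≤ A) (hB : 0 ≤ B) {s : ℝ}
    (hs : s ∈ Set.Icc (0 : ℝ) 1) :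
    A.trace.re - trPos (A - B) ≤ (A ^ s * B ^ (1 - s)).trace.re := by
  have hs' : 1 - s ∈ Set.Icc (0 : ℝ) 1 := ⟨by linarith [hs.2], by linarith [hs.1]⟩
  have hX : IsSelfAdjoint (A - B) := (IsSelfAdjoint.of_nonneg hA).sub (.of_nonneg hB)
  rw [trPos_eq_trace_cfc hX]
  set P := cfc (fun x : ℝ => max x 0) (A - B) with hP
  have hP0 : 0 ≤ P := cfc_nonneg fun x _ => le_max_right x 0
  have hAP : A ≤ B + P := by
    have : A - B ≤ P := by
      conv_lhs => rw [← cfc_id ℝ (A - B)]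
      exact cfc_mono fun x _ => le_max_left x 0
    simpa [add_comm] using sub_le_iff_le_add.mp this
  have hC : 0 ≤ B + P := add_nonneg hB hP0
  have hBC : B ≤ B + P := le_add_of_nonneg_right hP0
  have h₁ := re_trace_mul_nonneg (sub_nonneg.mpr (CFC.rpow_le_rpow hs hAP))
    (sub_nonneg.mpr (CFC.rpow_le_rpow hs' hBC))
  have h₂ := re_trace_mul_le_mul_left (CFC.rpow_nonneg (a := A) (y := s))
    (CFC.rpow_le_rpow hs' hAP)
  have h₃ := re_trace_mul_nonneg (sub_nonneg.mpr (CFC.rpow_le_rpow hs hBC))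
    (CFC.rpow_nonneg (a := B) (y := 1 - s))
  simp only [sub_mul, mul_sub, rpow_mul_rpow_one_sub hA, rpow_mul_rpow_one_sub hB,
    rpow_mul_rpow_one_sub hC, Matrix.trace_sub, Matrix.trace_add, Complex.sub_re,
    Complex.add_re] at h₁ h₂ h₃
  linarith

end TraceInequality


/-- For `γ ≥ 1` and `s ∈ (0,1)`:
`E_γ(ρ‖σ) ≥ 1 - γ^{1-s}·Q̄_s(ρ‖σ)` where `Q̄_s(ρ‖σ) = Tr[ρ^s σ^{1-s}]`. -/
theorem stmt_15 {n : Type*} [Fintype n] [DecidableEq n] (ρ σ : Matrix n n ℂ)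
    (hρ : IsDensity ρ) (hσ : IsDensity σ)
    (γ s : ℝ) (hγ : 1 ≤ γ) (hs : s ∈ Set.Ioo (0:ℝ) 1) :
    Egamma γ ρ σ ≥ 1 - γ ^ (1 - s) * (mpow hρ.1.1 s * mpow hσ.1.1 (1 - s)).trace.re := by
  have hρ0 := hρ.1.nonneg
  have hσ0 := hσ.1.nonneg
  have hγ0 : 0 ≤ γ := by linarith
  have h := re_trace_sub_trPos_le hρ0 (smul_nonneg hγ0 hσ0) ⟨hs.1.le, hs.2.le⟩
  rw [smul_rpow_of_nonneg hσ0 hγ0, mul_smul_comm, Matrix.trace_smul, Complex.smul_re, hρ.2,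
    Complex.one_re, smul_eq_mul] at h
  rw [mpow_eq_rpow hρ.1, mpow_eq_rpow hσ.1, Egamma, Complex.coe_smul]
  linarith
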